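/- Let G be a finite simple graph, and let s ≥ 2 and t ≥ 1 be integers. Then gn(G(t),s) = t·gn(G,s^t); equivalently, N(G(t),s) = N(G,s^t), where G(t) is the t-uniform blowup of G and the guessing game N(G,s^t) is played with an alphabet of size s^t. -/

import Mathlib

/-- A guessing strategy on graph `G` with alphabet `A`: each player `v` maps the
values of its neighbours to a guess of its own value. -/
def GuessStrategy {V : Type*} (G : SimpleGraph V) (A : Type*) : Type _ :=
  ∀ v : V, ((G.neighborSet v) → A) → A

/-- An assignment `a : V → A` is winning for the strategy `F` if every player
guesses its own value correctly. -/
def WinningAssignment {V : Type*} {G : SimpleGraph V} {A : Type*}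
    (F : GuessStrategy G A) (a : V → A) : Prop :=
  ∀ v : V, F v (fun u => a u.1) = a v

/-- The number of assignments won by strategy `F` in the game `(G, s)`. -/
noncomputable def winCount {V : Type*} (G : SimpleGraph V) (s : ℕ)
    (F : GuessStrategy G (Fin s)) : ℕ :=
  Nat.card {a : V → Fin s // WinningAssignment F a}

/-- `N(G,s)`: the maximum number of winning assignments over all strategies. -/
noncomputable def maxWinCount {V : Type*} (G : SimpleGraph V) (s : ℕ) : ℕ :=
  sSup {n | ∃ F : GuessStrategy G (Fin s), winCount G s F = n}

/-- The guessing number `gn(G,s) = log_s N(G,s)`. -/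
noncomputable def gn {V : Type*} (G : SimpleGraph V) (s : ℕ) : ℝ :=
  Real.logb s (maxWinCount G s)

/-- The `t`-uniform blowup of `G`. -/
def blowup {V : Type*} (G : SimpleGraph V) (t : ℕ) : SimpleGraph (V × Fin t) :=
  G.comap Prod.fst

/-- Assignments on the blowup over `Fin s` correspond to assignments on `G` over `Fin (s ^ t)`. -/
def blowupAssignmentEquiv (V : Type*) (s t : ℕ) :
    (V × Fin t → Fin s) ≃ (V → Fin (s ^ t)) :=
  (Equiv.curry V (Fin t) (Fin s)).trans (Equiv.piCongrRight fun _ => finFunctionFinEquiv)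

theorem blowupAssignmentEquiv_apply {V : Type*} {s t : ℕ} (a : V × Fin t → Fin s) (v : V) :
    blowupAssignmentEquiv V s t a v = finFunctionFinEquiv fun i => a (v, i) :=
  rfl

/-- Merge the guesses of the `t` copies of each vertex into one guess over `Fin (s ^ t)`. -/
def GuessStrategy.ofBlowup {V : Type*} {G : SimpleGraph V} {s t : ℕ}
    (F : GuessStrategy (blowup G t) (Fin s)) : GuessStrategy G (Fin (s ^ t)) :=
  fun v x => finFunctionFinEquiv fun i =>
    F (v, i) fun u => finFunctionFinEquiv.symm (x ⟨u.1.1, u.2⟩) u.1.2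

/-- Split the guess of each vertex over `Fin (s ^ t)` among its `t` copies. -/
def GuessStrategy.toBlowup {V : Type*} {G : SimpleGraph V} {s t : ℕ}
    (F : GuessStrategy G (Fin (s ^ t))) : GuessStrategy (blowup G t) (Fin s) :=
  fun p y => finFunctionFinEquiv.symm
    (F p.1 fun u => finFunctionFinEquiv fun j => y ⟨(u.1, j), u.2⟩) p.2

theorem winningAssignment_ofBlowup_iff {V : Type*} {G : SimpleGraph V} {s t : ℕ}
    (F : GuessStrategy (blowup G t) (Fin s)) (a : V × Fin t → Fin s) :
    WinningAssignment F a ↔ WinningAssignment F.ofBlowup (blowupAssignmentEquiv V s t a) := by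
  simp only [WinningAssignment, GuessStrategy.ofBlowup, blowupAssignmentEquiv_apply,
    Equiv.symm_apply_apply, EmbeddingLike.apply_eq_iff_eq, funext_iff, Prod.forall]

theorem winningAssignment_toBlowup_iff {V : Type*} {G : SimpleGraph V} {s t : ℕ}
    (F : GuessStrategy G (Fin (s ^ t))) (a : V × Fin t → Fin s) :
    WinningAssignment F.toBlowup a ↔ WinningAssignment F (blowupAssignmentEquiv V s t a) := by
  simp only [WinningAssignment, GuessStrategy.toBlowup, blowupAssignmentEquiv_apply,
    ← Equiv.symm_apply_eq, funext_iff, Prod.forall]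

theorem winCount_ofBlowup {V : Type*} {G : SimpleGraph V} {s t : ℕ}
    (F : GuessStrategy (blowup G t) (Fin s)) :
    winCount G (s ^ t) F.ofBlowup = winCount (blowup G t) s F :=
  (Nat.card_congr ((blowupAssignmentEquiv V s t).subtypeEquiv
    (winningAssignment_ofBlowup_iff F))).symm

theorem winCount_toBlowup {V : Type*} {G : SimpleGraph V} {s t : ℕ}
    (F : GuessStrategy G (Fin (s ^ t))) :
    winCount (blowup G t) s F.toBlowup = winCount G (s ^ t) F :=
  Nat.card_congr ((blowupAssignmentEquiv V s t).subtypeEquiv (winningAssignment_toBlowup_iff F))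

theorem maxWinCount_blowup {V : Type*} (G : SimpleGraph V) (s t : ℕ) :
    maxWinCount (blowup G t) s = maxWinCount G (s ^ t) := by
  unfold maxWinCount
  congr 1
  ext n
  constructor
  · rintro ⟨F, rfl⟩
    exact ⟨F.ofBlowup, winCount_ofBlowup F⟩
  · rintro ⟨F, rfl⟩
    exact ⟨F.toBlowup, winCount_toBlowup F⟩

/-- For a finite simple graph G and integers s ≥ 2, t ≥ 1,
gn(G(t),s) = t·gn(G,s^t); equivalently N(G(t),s) = N(G,s^t). -/
theorem blowup_guessing_number_eq {V : Type*} [Fintype V] (G : SimpleGraph V)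
    (s t : ℕ) (hs : 2 ≤ s) (ht : 1 ≤ t) :
    maxWinCount (blowup G t) s = maxWinCount G (s ^ t) ∧
      gn (blowup G t) s = (t : ℝ) * gn G (s ^ t) := by
  refine ⟨maxWinCount_blowup G s t, ?_⟩
  have ht' : (t : ℝ) ≠ 0 := by positivity
  have hs' : Real.log s ≠ 0 := (Real.log_pos (by exact_mod_cast hs)).ne'
  simp only [gn, maxWinCount_blowup, Real.logb, Nat.cast_pow, Real.log_pow]
  field_simp
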